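/- Let m ≥ 1 and let S ⊆ {1, ..., m-1} satisfy the closure condition: for every p ∈ S and all d₁, d₂ with 0 ≤ d₁, d₂ < m and d₁ + d₂ ≡ p (mod m), it holds that d₁ ∈ S or d₂ ∈ S. Then for every directed graph G: G has a cycle whose length, modulo m, belongs to S if and only if G has a closed walk whose length, modulo m, belongs to S. -/

import Mathlib

/-- `u` (a sequence of `k+1` vertices) is a walk of length `k ≥ 1` in the directed
graph with edge relation `E` (self-loops allowed). -/
def IsDirWalk {V : Type*} (E : V → V → Prop) (k : ℕ) (u : Fin (k + 1) → V) : Prop :=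
  1 ≤ k ∧ ∀ i : Fin k, E (u i.castSucc) (u i.succ)

/-- `u` is a closed walk of length `k` in the directed graph `E`:
a walk whose first and last vertices coincide. -/
def IsDirClosedWalk {V : Type*} (E : V → V → Prop) (k : ℕ) (u : Fin (k + 1) → V) : Prop :=
  IsDirWalk E k u ∧ u 0 = u (Fin.last k)

/-- `u` is a cycle of length `k` in the directed graph `E`: a closed walk
`(u₀, …, u_{k-1}, u₀)` in which `u₀, …, u_{k-1}` are `k` distinct vertices. -/
def IsDirCycle {V : Type*} (E : V → V → Prop) (k : ℕ) (u : Fin (k + 1) → V) : Prop :=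
  IsDirClosedWalk E k u ∧ Function.Injective fun i : Fin k => u i.castSucc

/-- A closed walk, given as a sequence indexed by `ℕ`, whose length modulo `m` lies in `S` contains
a cycle whose length modulo `m` lies in `S`. -/
theorem exists_isDirCycle_of_closed_seq {V : Type*} (m : ℕ) (hm : 1 ≤ m) (S : Set ℕ)
    (hclosed : ∀ p ∈ S, ∀ d₁ d₂ : ℕ, d₁ < m → d₂ < m →
      (d₁ + d₂) % m = p → d₁ ∈ S ∨ d₂ ∈ S)
    (E : V → V → Prop) (k : ℕ) (w : ℕ → V) (hk : 1 ≤ k) (hw : ∀ i < k, E (w i) (w (i + 1)))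
    (hw0 : w 0 = w k) (hkS : k % m ∈ S) :
    ∃ (l : ℕ) (C : Fin (l + 1) → V), IsDirCycle E l C ∧ l % m ∈ S := by
  induction k using Nat.strong_induction_on generalizing w with
  | _ k ih =>
  by_cases hinj : Function.Injective fun i : Fin k => w i
  · exact ⟨k, fun i => w i, ⟨⟨⟨hk, fun i => by simpa using hw i i.2⟩, by simpa using hw0⟩,
      hinj⟩, hkS⟩
  obtain ⟨i, j, hij, hjk, hwij⟩ : ∃ i j, i < j ∧ j < k ∧ w i = w j := by
    simp only [Function.Injective, not_forall] at hinj
    obtain ⟨a, b, hab, hne⟩ := hinj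
    rcases lt_or_gt_of_ne (fun h => hne (Fin.ext h) : (a : ℕ) ≠ b) with h | h
    · exact ⟨a, b, h, b.2, hab⟩
    · exact ⟨b, a, h, a.2, hab.symm⟩
  have hsum : ((j - i) % m + (k - (j - i)) % m) % m = k % m := by
    rw [← Nat.add_mod, Nat.add_sub_cancel' (by omega)]
  rcases hclosed _ hkS _ _ (Nat.mod_lt _ hm) (Nat.mod_lt _ hm) hsum with h | h
  · refine ih (j - i) (by omega) (fun n => w (i + n)) (by omega)
      (fun n hn => hw (i + n) (by omega)) ?_ h
    simpa [Nat.add_sub_cancel' hij.le] using hwij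
  · refine ih (k - (j - i)) (by omega) (fun n => if n ≤ i then w n else w (n + (j - i)))
      (by omega) (fun n hn => ?_) ?_ h
    · rcases lt_trichotomy n i with hni | rfl | hni
      · rw [if_pos hni.le, if_pos (by omega)]
        exact hw n (by omega)
      · rw [if_pos le_rfl, if_neg (by omega), hwij,
          show n + 1 + (j - n) = j + 1 by omega]
        exact hw j hjk
      · rw [if_neg (by omega), if_neg (by omega), add_right_comm]
        exact hw _ (by omega)
    · rw [if_pos (Nat.zero_le i), if_neg (by omega), Nat.sub_add_cancel (by omega), hw0]

/-- Let m ≥ 1 and let S ⊆ {1, ..., m-1} satisfy the closure condition.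
Then for every directed graph G: G has a cycle whose length, modulo m, belongs to S
iff G has a closed walk whose length, modulo m, belongs to S. -/
theorem stmt_6 {V : Type*} (m : ℕ) (hm : 1 ≤ m) (S : Set ℕ)
    (hSsub : S ⊆ {x | 0 < x ∧ x < m})
    (hclosed : ∀ p ∈ S, ∀ d₁ d₂ : ℕ, d₁ < m → d₂ < m →
      (d₁ + d₂) % m = p → d₁ ∈ S ∨ d₂ ∈ S)
    (E : V → V → Prop) :
    (∃ (ℓ : ℕ) (C : Fin (ℓ + 1) → V), IsDirCycle E ℓ C ∧ ℓ % m ∈ S) ↔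
    (∃ (k : ℕ) (W : Fin (k + 1) → V), IsDirClosedWalk E k W ∧ k % m ∈ S) := by
  constructor
  · rintro ⟨l, C, hC, hl⟩
    exact ⟨l, C, hC.1, hl⟩
  · rintro ⟨k, W, ⟨⟨hk, hE⟩, h0⟩, hkS⟩
    refine exists_isDirCycle_of_closed_seq m hm S hclosed E k (fun n => W (Fin.ofNat (k + 1) n))
      hk (fun i hi => ?_) ?_ hkS
    · convert hE ⟨i, hi⟩ using 2 <;> ext <;> simp <;> omega
    · convert h0 using 2 <;> ext <;> simp
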